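/- (Cherednik's one-variable Macdonald-Mehta integral) Let τ ∈ ℍ, q = exp(2πiτ), q̃ = exp(-2πi/τ), and k ∈ ℝ_{>0}. Then ∫_{-∞}^∞ [(e^{4πix}; q̃²)_∞ (e^{-4πix}; q̃²)_∞ / ((q̃^{2k} e^{4πix}; q̃²)_∞ (q̃^{2k} e^{-4πix}; q̃²)_∞)] · q^{x²/2} dx = (2/√(-iτ)) · (q̃^{2k}; q̃²)_∞ / (q̃^{4k}; q̃²)_∞. -/

import Mathlib

open scoped Real

/-- The infinite q-Pochhammer symbol `(a;q)_∞ = ∏_{j=0}^∞ (1 - a q^j)`. -/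
noncomputable def qPochInf (a q : ℂ) : ℂ := ∏' n : ℕ, (1 - a * q ^ n)

/-- `q̃^u = exp(-2πiu/τ)`. -/
noncomputable def qtPow (τ u : ℂ) : ℂ := Complex.exp (-(2 * (π : ℂ) * Complex.I * u) / τ)

section QPochhammer

open Filter Topology

variable {p : ℂ}

theorem summable_norm_neg_mul_pow (hp : ‖p‖ < 1) (a : ℂ) :
    Summable fun n : ℕ => ‖-(a * p ^ n)‖ := by
  simpa using (summable_geometric_of_lt_one (norm_nonneg p) hp).mul_left ‖a‖

theorem multipliable_one_sub_mul_pow (hp : ‖p‖ < 1) (a : ℂ) :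
    Multipliable fun n : ℕ => 1 - a * p ^ n := by
  simpa [sub_eq_add_neg] using multipliable_one_add_of_summable (summable_norm_neg_mul_pow hp a)

@[simp]
theorem qPochInf_zero (p : ℂ) : qPochInf 0 p = 1 := by
  simp [qPochInf]

theorem qPochInf_eq_one_sub_mul (hp : ‖p‖ < 1) (a : ℂ) :
    qPochInf a p = (1 - a) * qPochInf (a * p) p := by
  have h (n : ℕ) : 1 - a * p ^ (n + 1) = 1 - a * p * p ^ n := by ring
  unfold qPochInf
  rw [tprod_eq_zero_mul' (by simpa only [h] using multipliable_one_sub_mul_pow hp (a * p))]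
  simp [h]

theorem qPochInf_ne_zero (hp : ‖p‖ < 1) {a : ℂ} (ha : ‖a‖ < 1) : qPochInf a p ≠ 0 := by
  have h := tprod_one_add_ne_zero_of_summable (f := fun n : ℕ => -(a * p ^ n)) (fun n hn => ?_)
    (summable_norm_neg_mul_pow hp a)
  · simpa only [qPochInf, sub_eq_add_neg] using h
  · have h1 : a * p ^ n = 1 := by linear_combination -hn
    have h2 : ‖a * p ^ n‖ < 1 := by
      rw [norm_mul, norm_pow]
      exact (mul_le_of_le_one_right (norm_nonneg a)
        (pow_le_one₀ (norm_nonneg p) hp.le)).trans_lt ha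
    simp [h1] at h2

theorem differentiable_qPochInf (hp : ‖p‖ < 1) : Differentiable ℂ fun a => qPochInf a p := by
  intro a
  have h : HasProdLocallyUniformlyOn (fun (n : ℕ) (x : ℂ) => 1 + -(x * p ^ n))
      (fun x => ∏' n : ℕ, (1 + -(x * p ^ n))) (Metric.ball 0 (‖a‖ + 1)) := by
    refine Summable.hasProdLocallyUniformlyOn_nat_one_add Metric.isOpen_ball
      ((summable_geometric_of_lt_one (norm_nonneg p) hp).mul_left (‖a‖ + 1))
      (.of_forall fun n x hx => ?_) (fun n => by fun_prop)
    rw [mem_ball_zero_iff] at hx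
    rw [norm_neg, norm_mul, norm_pow]
    gcongr
  have hd : DifferentiableOn ℂ (fun x => ∏' n : ℕ, (1 + -(x * p ^ n)))
      (Metric.ball 0 (‖a‖ + 1)) :=
    h.differentiableOn (.of_forall fun _ => by
      simpa [Finset.prod_fn] using DifferentiableOn.finsetProd (fun _ _ => by fun_prop))
      Metric.isOpen_ball
  simpa only [qPochInf, sub_eq_add_neg] using
    hd.differentiableAt (Metric.isOpen_ball.mem_nhds (by simp))

end QPochhammer

section Kernel

open Filter Topology

variable {p t z : ℂ}

/-- The asymmetric weight `(z;p)_∞ (p/z;p)_∞ / ((tz;p)_∞ (tp/z;p)_∞)`, whose symmetrization under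
`z ↦ z⁻¹` is proportional to Macdonald's symmetric weight of type `A₁`. -/
noncomputable def asymWeight (p t z : ℂ) : ℂ :=
  qPochInf z p * qPochInf (p * z⁻¹) p / (qPochInf (t * z) p * qPochInf (t * (p * z⁻¹)) p)

theorem norm_mul_inv_le_one (hz : ‖p‖ ≤ ‖z‖) : ‖p * z⁻¹‖ ≤ 1 := by
  rw [norm_mul, norm_inv, ← div_eq_mul_inv]
  exact div_le_one_of_le₀ hz (norm_nonneg z)

theorem norm_mul_lt_one {u : ℂ} (ht : ‖t‖ < 1) (hu : ‖u‖ ≤ 1) : ‖t * u‖ < 1 := by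
  rw [norm_mul]
  exact (mul_le_of_le_one_right (norm_nonneg t) hu).trans_lt ht

theorem asymWeight_mul_left (hp0 : p ≠ 0) (t z : ℂ) :
    asymWeight p t (p * z) = asymWeight p t z⁻¹ := by
  have h : p * (p * z)⁻¹ = z⁻¹ := by rw [mul_inv, mul_inv_cancel_left₀ hp0]
  unfold asymWeight
  rw [h, inv_inv, mul_comm (qPochInf (p * z) p), mul_comm (qPochInf (t * (p * z)) p)]

theorem differentiableAt_asymWeight (hp : ‖p‖ < 1) (hp0 : p ≠ 0) (ht : ‖t‖ < 1)
    (hz : ‖p‖ ≤ ‖z‖) (hz1 : ‖z‖ ≤ 1) : DifferentiableAt ℂ (asymWeight p t) z := by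
  have hz0 : z ≠ 0 := norm_pos_iff.mp ((norm_pos_iff.mpr hp0).trans_le hz)
  have hd := differentiable_qPochInf hp
  have hinv : DifferentiableAt ℂ (fun w : ℂ => p * w⁻¹) z :=
    (differentiableAt_inv hz0).const_mul p
  refine DifferentiableAt.div (.mul (hd z) ?_) (.mul ?_ ?_) (mul_ne_zero ?_ ?_)
  · exact (hd (p * z⁻¹)).comp z hinv
  · exact (hd (t * z)).comp z (by fun_prop)
  · exact (hd (t * (p * z⁻¹))).comp z (hinv.const_mul t)
  · exact qPochInf_ne_zero hp (norm_mul_lt_one ht hz1)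
  · exact qPochInf_ne_zero hp (norm_mul_lt_one ht (norm_mul_inv_le_one hz))

theorem continuousAt_asymWeight_param (hp : ‖p‖ < 1) (ht : ‖t‖ < 1)
    (hz : ‖p‖ ≤ ‖z‖) (hz1 : ‖z‖ ≤ 1) : ContinuousAt (fun s => asymWeight p s z) t := by
  have hc := (differentiable_qPochInf hp).continuous
  refine ContinuousAt.div continuousAt_const (Continuous.continuousAt ?_) (mul_ne_zero ?_ ?_)
  · exact (hc.comp (continuous_mul_const z)).mul (hc.comp (continuous_mul_const (p * z⁻¹)))
  · exact qPochInf_ne_zero hp (norm_mul_lt_one ht hz1)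
  · exact qPochInf_ne_zero hp (norm_mul_lt_one ht (norm_mul_inv_le_one hz))

theorem exists_norm_asymWeight_le (hp : ‖p‖ < 1) {r : ℝ} (hr : r < 1) :
    ∃ C : ℝ, 0 ≤ C ∧ ∀ t z : ℂ, ‖t‖ ≤ r → ‖p‖ ≤ ‖z‖ → ‖z‖ ≤ 1 → ‖asymWeight p t z‖ ≤ C := by
  have hc := (differentiable_qPochInf hp).continuous
  obtain ⟨B, hB⟩ := (isCompact_closedBall (0 : ℂ) 1).exists_bound_of_continuousOn hc.continuousOn
  obtain ⟨D, hD⟩ := (isCompact_closedBall (0 : ℂ) r).exists_bound_of_continuousOn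
    (f := fun u => (qPochInf u p)⁻¹) (hc.continuousOn.inv₀ fun u hu =>
      qPochInf_ne_zero hp ((mem_closedBall_zero_iff.mp hu).trans_lt hr))
  simp only [mem_closedBall_zero_iff] at hB hD
  have hB0 : 0 ≤ B := (norm_nonneg _).trans (hB 0 (by simp))
  refine ⟨B * B * (D * D), mul_nonneg (mul_nonneg hB0 hB0) (mul_self_nonneg D),
    fun t z ht hz hz1 => ?_⟩
  have hr0 : 0 ≤ r := (norm_nonneg t).trans ht
  have hD0 : 0 ≤ D := (norm_nonneg _).trans (hD 0 (by simpa using hr0))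
  have hle {u : ℂ} (hu : ‖u‖ ≤ 1) : ‖t * u‖ ≤ r := by
    rw [norm_mul]
    exact (mul_le_of_le_one_right (norm_nonneg t) hu).trans ht
  have hpz := norm_mul_inv_le_one hz
  rw [asymWeight, div_eq_mul_inv, mul_inv, norm_mul, norm_mul, norm_mul]
  gcongr
  · exact hB _ hz1
  · exact hB _ hpz
  · exact hD _ (hle hz1)
  · exact hD _ (hle hpz)

theorem one_sub_mul_ne_zero {u : ℂ} (ht : ‖t‖ < 1) (hu : ‖u‖ ≤ 1) : 1 - t * u ≠ 0 := by
  intro h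
  have h1 := norm_mul_lt_one ht hu
  rw [← sub_eq_zero.mp h] at h1
  simp at h1

theorem asymWeight_inv_mul (hp : ‖p‖ < 1) (ht : ‖t‖ < 1) (hz : ‖z‖ = 1) :
    asymWeight p t z⁻¹ * (1 - t * z⁻¹) = (t - z⁻¹) * asymWeight p t z := by
  have hz0 : z ≠ 0 := norm_ne_zero_iff.mp (by simp [hz])
  have hzi : ‖z⁻¹‖ = 1 := by simp [hz]
  have h1 := one_sub_mul_ne_zero ht hz.le
  have h2 := one_sub_mul_ne_zero ht hzi.le
  have h3 := qPochInf_ne_zero hp (norm_mul_lt_one (norm_mul_lt_one ht hz.le) hp.le)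
  have h4 := qPochInf_ne_zero hp (norm_mul_lt_one (norm_mul_lt_one ht hzi.le) hp.le)
  simp only [asymWeight, inv_inv]
  rw [qPochInf_eq_one_sub_mul hp z, qPochInf_eq_one_sub_mul hp z⁻¹,
    qPochInf_eq_one_sub_mul hp (t * z), qPochInf_eq_one_sub_mul hp (t * z⁻¹),
    show t * (p * z) = t * z * p by ring, show t * (p * z⁻¹) = t * z⁻¹ * p by ring,
    mul_comm p z, mul_comm p z⁻¹]
  generalize qPochInf (t * z * p) p = A at *
  generalize qPochInf (t * z⁻¹ * p) p = B at *
  generalize qPochInf (z * p) p = C at *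
  generalize qPochInf (z⁻¹ * p) p = D at *
  generalize hw : z⁻¹ = w at *
  have hzw : z * w = 1 := by rw [← hw, mul_inv_cancel₀ hz0]
  generalize hE : 1 - t * z = E at *
  generalize hF : 1 - t * w = F at *
  field_simp
  linear_combination C * D * (t - 1) * hzw - (1 - w) * D * C * hE

theorem asymWeight_mul_param (hp : ‖p‖ < 1) (ht : ‖t‖ < 1) (hz : ‖z‖ = 1) :
    asymWeight p (t * p) z = (1 - t * z) * (1 - t * (p * z⁻¹)) * asymWeight p t z := by
  have hpz := norm_mul_inv_le_one (p := p) (z := z) (by rw [hz]; exact hp.le)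
  have h1 := one_sub_mul_ne_zero ht hz.le
  have h2 := one_sub_mul_ne_zero ht hpz
  simp only [asymWeight]
  rw [qPochInf_eq_one_sub_mul hp (t * z), qPochInf_eq_one_sub_mul hp (t * (p * z⁻¹)),
    show t * p * z = t * z * p by ring, show t * p * (p * z⁻¹) = t * (p * z⁻¹) * p by ring]
  rw [mul_mul_mul_comm (1 - t * z), mul_div_assoc', mul_div_mul_left _ _ (mul_ne_zero h1 h2)]

theorem asymWeight_self (hp : ‖p‖ < 1) (hz : ‖z‖ = 1) :
    asymWeight p p z = (1 - z) * (1 - p * z⁻¹) := by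
  have hpz := norm_mul_inv_le_one (p := p) (z := z) (by rw [hz]; exact hp.le)
  have h1 := qPochInf_ne_zero hp (norm_mul_lt_one hp hz.le)
  have h2 := qPochInf_ne_zero hp (norm_mul_lt_one hp hpz)
  simp only [asymWeight]
  rw [qPochInf_eq_one_sub_mul hp z, qPochInf_eq_one_sub_mul hp (p * z⁻¹), mul_comm z p,
    mul_comm (p * z⁻¹) p, mul_mul_mul_comm, mul_div_cancel_right₀ _ (mul_ne_zero h1 h2)]

theorem asymWeight_add_asymWeight_inv (hp : ‖p‖ < 1) (ht : ‖t‖ < 1) (hz : ‖z‖ = 1) :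
    asymWeight p t z + asymWeight p t z⁻¹ = (1 + t) * (qPochInf z p * qPochInf z⁻¹ p /
      (qPochInf (t * z) p * qPochInf (t * z⁻¹) p)) := by
  have hz0 : z ≠ 0 := norm_ne_zero_iff.mp (by simp [hz])
  have hzi : ‖z⁻¹‖ = 1 := by simp [hz]
  have h1 := one_sub_mul_ne_zero ht hz.le
  have h2 := one_sub_mul_ne_zero ht hzi.le
  have h3 := qPochInf_ne_zero hp (norm_mul_lt_one (norm_mul_lt_one ht hz.le) hp.le)
  have h4 := qPochInf_ne_zero hp (norm_mul_lt_one (norm_mul_lt_one ht hzi.le) hp.le)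
  simp only [asymWeight, inv_inv]
  rw [qPochInf_eq_one_sub_mul hp z, qPochInf_eq_one_sub_mul hp z⁻¹,
    qPochInf_eq_one_sub_mul hp (t * z), qPochInf_eq_one_sub_mul hp (t * z⁻¹),
    show t * (p * z) = t * z * p by ring, show t * (p * z⁻¹) = t * z⁻¹ * p by ring,
    mul_comm p z, mul_comm p z⁻¹]
  generalize qPochInf (t * z * p) p = A at *
  generalize qPochInf (t * z⁻¹ * p) p = B at *
  generalize qPochInf (z * p) p = C at *
  generalize qPochInf (z⁻¹ * p) p = D at *
  generalize hw : z⁻¹ = w at *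
  have hzw : z * w = 1 := by rw [← hw, mul_inv_cancel₀ hz0]
  generalize hE : 1 - t * z = E at *
  generalize hF : 1 - t * w = F at *
  field_simp
  linear_combination C * D * (t - 1) * hzw - C * D * (1 - w) * hE - C * D * (1 - z) * hF

end Kernel

section ContourShift

open MeasureTheory Filter Topology Set Complex

theorem integral_eq_integral_add_mul_I {F : ℂ → ℂ} {G : ℝ → ℝ} {c : ℝ} (hc : 0 ≤ c)
    (hF : DifferentiableOn ℂ F {z | z.im ∈ Icc 0 c})
    (hFG : ∀ x : ℝ, ∀ y ∈ Icc 0 c, ‖F (x + y * I)‖ ≤ G x) (hG : Integrable G)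
    (hG_top : Tendsto G atTop (𝓝 0)) (hG_bot : Tendsto G atBot (𝓝 0)) :
    ∫ x : ℝ, F x = ∫ x : ℝ, F (x + c * I) := by
  have h_int (y : ℝ) (hy : y ∈ Icc 0 c) : Integrable fun x : ℝ => F (x + y * I) := by
    refine hG.mono' (Continuous.aestronglyMeasurable ?_) (.of_forall fun x => hFG x y hy)
    refine hF.continuousOn.comp_continuous (by fun_prop) fun x => ?_
    simpa using hy
  have h_int0 : Integrable fun x : ℝ => F x := by simpa using h_int 0 ⟨le_rfl, hc⟩
  have hside {u : ℝ → ℝ} (hu : Tendsto (fun T => G (u T)) atTop (𝓝 0)) :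
      Tendsto (fun T => I • ∫ y : ℝ in (0 : ℝ)..c, F (u T + y * I)) atTop (𝓝 0) := by
    refine squeeze_zero_norm (a := fun T => G (u T) * |c - 0|) (fun T => ?_)
      (by simpa using hu.mul_const |c - 0|)
    rw [norm_smul, norm_I, one_mul]
    refine intervalIntegral.norm_integral_le_of_norm_le_const fun y hy => ?_
    rw [uIoc_of_le hc] at hy
    exact hFG _ y ⟨hy.1.le, hy.2⟩
  have hrect (T : ℝ) : (∫ x : ℝ in -T..T, F x) - (∫ x : ℝ in -T..T, F (x + c * I)) +
      I • (∫ y : ℝ in (0 : ℝ)..c, F ((T : ℝ) + y * I)) -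
      I • (∫ y : ℝ in (0 : ℝ)..c, F ((-T : ℝ) + y * I)) = 0 := by
    have := integral_boundary_rect_eq_zero_of_differentiableOn F (-T : ℝ) (T + c * I)
      (hF.mono fun z hz => by simpa [uIcc_of_le hc] using (mem_reProdIm.mp hz).2)
    simpa using this
  have hlim := ((((intervalIntegral_tendsto_integral h_int0 tendsto_neg_atTop_atBot
    tendsto_id).sub (intervalIntegral_tendsto_integral (h_int c ⟨hc, le_rfl⟩)
    tendsto_neg_atTop_atBot tendsto_id)).add (hside (u := id) hG_top)).sub
    (hside (u := Neg.neg) (hG_bot.comp tendsto_neg_atTop_atBot)))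
  have h := tendsto_nhds_unique hlim (tendsto_const_nhds.congr fun T => (hrect T).symm)
  linear_combination h

end ContourShift

section Gaussian

open MeasureTheory Filter Topology Set Complex

variable {τ : ℂ}

/-- The Gaussian `q^{x²/2} = exp(πiτx²)` times the exponential `exp(4πiax)`. -/
noncomputable def gaussExp (τ a x : ℂ) : ℂ := cexp (π * I * τ * x ^ 2 + 4 * π * I * a * x)

theorem differentiable_gaussExp (τ a : ℂ) : Differentiable ℂ (gaussExp τ a) := by
  unfold gaussExp
  fun_prop

theorem gaussExp_neg (τ a x : ℂ) : gaussExp τ a (-x) = gaussExp τ (-a) x := by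
  unfold gaussExp
  ring_nf

theorem gaussExp_add (τ a b x : ℂ) :
    gaussExp τ (a + b) x = cexp (4 * π * I * b * x) * gaussExp τ a x := by
  rw [gaussExp, gaussExp, ← Complex.exp_add]
  ring_nf

theorem gaussExp_sub_inv (hτ : τ ≠ 0) (a x : ℂ) : gaussExp τ a (x - τ⁻¹) =
    cexp (-(4 * π * I * (a - 1 / 4)) / τ) * gaussExp τ (a - 1 / 2) x := by
  rw [gaussExp, gaussExp, ← Complex.exp_add]
  congr 1
  field_simp
  ring

theorem pi_mul_I_mul_re_neg (hτ : 0 < τ.im) : (π * I * τ).re < 0 := by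
  simpa using mul_pos Real.pi_pos hτ

theorem integrable_gaussExp (hτ : 0 < τ.im) (a : ℂ) : Integrable fun x : ℝ => gaussExp τ a x := by
  simpa [gaussExp] using integrable_cexp_quadratic' (pi_mul_I_mul_re_neg hτ) (4 * π * I * a) 0

theorem integral_gaussExp (hτ : 0 < τ.im) (a : ℂ) : ∫ x : ℝ, gaussExp τ a x =
    ((-I * τ) ^ (1 / 2 : ℂ))⁻¹ * cexp (-(4 * π * I * a ^ 2) / τ) := by
  have hτ0 : τ ≠ 0 := by rintro rfl; simp at hτ
  have hπ : (π : ℂ) ≠ 0 := ofReal_ne_zero.mpr Real.pi_ne_zero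
  have h := integral_cexp_quadratic (pi_mul_I_mul_re_neg hτ) (4 * π * I * a) 0
  simp only [add_zero] at h
  have harg : (-I * τ).arg ≠ π := by
    rw [Ne, arg_eq_pi_iff, not_and_or]
    left
    simpa using hτ.le
  have h1 : (π : ℂ) / -(π * I * τ) = (-I * τ)⁻¹ := by
    rw [show -(π * I * τ) = π * (-I * τ) by ring, div_eq_mul_inv, mul_inv,
      mul_inv_cancel_left₀ hπ]
  have h2 : 0 - (4 * π * I * a) ^ 2 / (4 * (π * I * τ)) = -(4 * π * I * a ^ 2) / τ := by
    field_simp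
    ring
  rw [← inv_cpow _ _ harg, ← h1, ← h2, ← h]
  rfl

theorem exists_norm_gaussExp_le (hτ : 0 < τ.im) (a : ℂ) (c : ℝ) : ∃ C : ℝ, 0 ≤ C ∧
    ∀ x : ℝ, ∀ y ∈ Icc 0 c,
      ‖gaussExp τ a (x + y * I)‖ ≤ C * Real.exp (-(π * τ.im / 2) * x ^ 2) := by
  set D : ℝ := 2 * |τ.re| * c + 4 * |a.im|
  refine ⟨Real.exp (π * (D ^ 2 / (2 * τ.im) + τ.im * c ^ 2 + 4 * |a.re| * c)),
    (Real.exp_pos _).le, fun x y ⟨hy, hyc⟩ => ?_⟩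
  have hre : (π * I * τ * (x + y * I) ^ 2 + 4 * π * I * a * (x + y * I)).re =
      π * (-(τ.im * x ^ 2) - (2 * τ.re * y + 4 * a.im) * x + τ.im * y ^ 2 - 4 * a.re * y) := by
    simp [pow_two]
    ring
  rw [gaussExp, norm_exp, hre, ← Real.exp_add, Real.exp_le_exp]
  have h1 : |2 * τ.re * y + 4 * a.im| ≤ D := by
    refine (abs_add_le _ _).trans ?_
    rw [abs_mul, abs_mul, abs_mul, abs_two, abs_of_nonneg hy, abs_of_pos (by norm_num : (0:ℝ) < 4)]
    change _ ≤ 2 * |τ.re| * c + 4 * |a.im|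
    gcongr
  have h2 : -((2 * τ.re * y + 4 * a.im) * x) ≤ D * |x| := by
    refine (neg_le_abs _).trans ?_
    rw [abs_mul]
    gcongr
  have h3 : D * |x| ≤ D ^ 2 / (2 * τ.im) + τ.im / 2 * x ^ 2 := by
    rw [← sq_abs x]
    have h : D ^ 2 / (2 * τ.im) + τ.im / 2 * |x| ^ 2 - D * |x| =
        (D - τ.im * |x|) ^ 2 / (2 * τ.im) := by
      field_simp
      ring
    have : 0 ≤ (D - τ.im * |x|) ^ 2 / (2 * τ.im) := by positivity
    linarith
  have h4 : τ.im * y ^ 2 ≤ τ.im * c ^ 2 := by gcongr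
  have h5 : -(4 * a.re * y) ≤ 4 * |a.re| * c := by
    calc -(4 * a.re * y) = 4 * -a.re * y := by ring
      _ ≤ 4 * |a.re| * c :=
        mul_le_mul (by linarith [neg_le_abs a.re]) hyc hy (by positivity)
  calc _ ≤ π * (-(τ.im * x ^ 2) + (D ^ 2 / (2 * τ.im) + τ.im / 2 * x ^ 2) + τ.im * c ^ 2 +
        4 * |a.re| * c) := by
        gcongr
        linarith
    _ = _ := by ring

end Gaussian

section MacdonaldMehta

open MeasureTheory Filter Topology Set Complex

variable {τ t : ℂ}

theorem qtPow_two (τ : ℂ) : qtPow τ 2 = cexp (4 * π * I * -τ⁻¹) := by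
  rw [qtPow, div_eq_mul_inv]
  ring_nf

theorem norm_cexp_four_pi_mul (z : ℂ) : ‖cexp (4 * π * I * z)‖ = Real.exp (-(4 * π) * z.im) := by
  rw [norm_exp]
  congr 1
  simp

theorem norm_cexp_four_pi_mul_ofReal (x : ℝ) : ‖cexp (4 * π * I * x)‖ = 1 := by
  simp [norm_cexp_four_pi_mul]

theorem neg_inv_im_pos (hτ : 0 < τ.im) : 0 < (-τ⁻¹).im := by
  have hτ0 : τ ≠ 0 := by rintro rfl; simp at hτ
  rw [neg_im, inv_im, neg_div, neg_neg]
  exact div_pos hτ (normSq_pos.mpr hτ0)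

theorem norm_qtPow_two_lt_one (hτ : 0 < τ.im) : ‖qtPow τ 2‖ < 1 := by
  rw [qtPow_two, norm_cexp_four_pi_mul, Real.exp_lt_one_iff]
  have := mul_pos Real.pi_pos (neg_inv_im_pos hτ)
  linarith

theorem qtPow_ne_zero (τ u : ℂ) : qtPow τ u ≠ 0 :=
  Complex.exp_ne_zero _

theorem norm_qtPow_two_le {z : ℂ} (hz : z.im ∈ Icc 0 (-τ⁻¹).im) :
    ‖qtPow τ 2‖ ≤ ‖cexp (4 * π * I * z)‖ ∧ ‖cexp (4 * π * I * z)‖ ≤ 1 := by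
  rw [qtPow_two, norm_cexp_four_pi_mul, norm_cexp_four_pi_mul, Real.exp_le_exp,
    Real.exp_le_one_iff]
  constructor <;> nlinarith [Real.pi_pos, hz.1, hz.2]

/-- The Gaussian moments `∫ w(e^{4πix}) e^{4πiax} q^{x²/2} dx` of the asymmetric weight `w`. -/
noncomputable def asymMoment (τ t a : ℂ) : ℂ :=
  ∫ x : ℝ, asymWeight (qtPow τ 2) t (cexp (4 * π * I * x)) * gaussExp τ a x

theorem exists_norm_asymWeight_mul_gaussExp_le (hτ : 0 < τ.im) (a : ℂ) {r : ℝ} (hr : r < 1) :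
    ∃ C : ℝ, ∀ t : ℂ, ‖t‖ ≤ r → ∀ x : ℝ, ∀ y ∈ Icc 0 (-τ⁻¹).im,
      ‖asymWeight (qtPow τ 2) t (cexp (4 * π * I * (x + y * I))) * gaussExp τ a (x + y * I)‖ ≤
        C * Real.exp (-(π * τ.im / 2) * x ^ 2) := by
  obtain ⟨A, hA0, hA⟩ := exists_norm_asymWeight_le (norm_qtPow_two_lt_one hτ) hr
  obtain ⟨B, hB0, hB⟩ := exists_norm_gaussExp_le hτ a (-τ⁻¹).im
  refine ⟨A * B, fun t ht x y hy => ?_⟩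
  have hz := norm_qtPow_two_le (z := x + y * I) (by simpa using hy)
  rw [norm_mul, mul_assoc A]
  exact mul_le_mul (hA t _ ht hz.1 hz.2) (hB x y hy) (norm_nonneg _) hA0

theorem continuous_asymWeight_mul_gaussExp (hτ : 0 < τ.im) (ht : ‖t‖ < 1) (a : ℂ) :
    Continuous fun x : ℝ => asymWeight (qtPow τ 2) t (cexp (4 * π * I * x)) * gaussExp τ a x := by
  have hp := norm_qtPow_two_lt_one hτ
  refine .mul ?_ ((differentiable_gaussExp τ a).continuous.comp continuous_ofReal)
  refine continuous_iff_continuousAt.mpr fun x => ?_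
  have hx := norm_cexp_four_pi_mul_ofReal x
  exact ContinuousAt.comp (f := fun x : ℝ => cexp (4 * π * I * x))
    (differentiableAt_asymWeight hp (qtPow_ne_zero τ 2) ht (hx ▸ hp.le) hx.le).continuousAt
    (by fun_prop)

theorem integrable_asymWeight_mul_gaussExp (hτ : 0 < τ.im) (ht : ‖t‖ < 1) (a : ℂ) :
    Integrable fun x : ℝ => asymWeight (qtPow τ 2) t (cexp (4 * π * I * x)) * gaussExp τ a x := by
  obtain ⟨C, hC⟩ := exists_norm_asymWeight_mul_gaussExp_le hτ a ht
  refine ((integrable_exp_neg_mul_sq (half_pos (mul_pos Real.pi_pos hτ))).const_mul C).mono'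
    (continuous_asymWeight_mul_gaussExp hτ ht a).aestronglyMeasurable (.of_forall fun x => ?_)
  simpa using hC t le_rfl x 0 ⟨le_rfl, (neg_inv_im_pos hτ).le⟩

theorem tendsto_exp_neg_mul_sq {b : ℝ} (hb : 0 < b) {l : Filter ℝ}
    (hl : Tendsto (fun x : ℝ => x ^ 2) l atTop) (C : ℝ) :
    Tendsto (fun x : ℝ => C * Real.exp (-b * x ^ 2)) l (𝓝 0) := by
  simpa using (Real.tendsto_exp_atBot.comp
    (hl.const_mul_atTop_of_neg (neg_neg_of_pos hb))).const_mul C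

theorem cexp_four_pi_mul_neg (x : ℂ) : cexp (4 * π * I * -x) = (cexp (4 * π * I * x))⁻¹ := by
  rw [← Complex.exp_neg]
  ring_nf

theorem asymMoment_eq (hτ : 0 < τ.im) (ht : ‖t‖ < 1) (a : ℂ) : asymMoment τ t a =
    cexp (-(4 * π * I * (a - 1 / 4)) / τ) * asymMoment τ t (1 / 2 - a) := by
  have hτ0 : τ ≠ 0 := by rintro rfl; simp at hτ
  have hp := norm_qtPow_two_lt_one hτ
  have hc := neg_inv_im_pos hτ
  have hb : 0 < π * τ.im / 2 := half_pos (mul_pos Real.pi_pos hτ)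
  set F : ℂ → ℂ := fun z => asymWeight (qtPow τ 2) t (cexp (4 * π * I * z)) * gaussExp τ a z
  obtain ⟨C, hC⟩ := exists_norm_asymWeight_mul_gaussExp_le hτ a ht
  have hF : DifferentiableOn ℂ F {z | z.im ∈ Icc 0 (-τ⁻¹).im} := by
    intro z hz
    have hz := norm_qtPow_two_le hz
    refine (DifferentiableAt.mul ?_ (differentiable_gaussExp τ a z)).differentiableWithinAt
    exact (differentiableAt_asymWeight hp (qtPow_ne_zero τ 2) ht hz.1 hz.2).comp z
      (f := fun z => cexp (4 * π * I * z)) (by fun_prop)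
  have hshift : asymMoment τ t a = ∫ x : ℝ, F (x + (-τ⁻¹).im * I) :=
    integral_eq_integral_add_mul_I hc.le hF (hC t le_rfl)
      ((integrable_exp_neg_mul_sq hb).const_mul C)
      (tendsto_exp_neg_mul_sq hb (tendsto_pow_atTop two_ne_zero) C)
      (tendsto_exp_neg_mul_sq hb (by simpa [Function.comp_def] using
        (tendsto_pow_atTop (α := ℝ) two_ne_zero).comp tendsto_neg_atBot_atTop) C)
  have htranslate : ∫ x : ℝ, F (x + (-τ⁻¹).im * I) = ∫ x : ℝ, F (x + -τ⁻¹) := by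
    rw [← integral_add_right_eq_self (fun x : ℝ => F (x + (-τ⁻¹).im * I)) (-τ⁻¹).re]
    congr 1 with x
    conv_rhs => rw [← re_add_im (-τ⁻¹)]
    push_cast
    rw [add_assoc]
  have hF_eq (x : ℝ) : F ((-x : ℝ) + -τ⁻¹) = cexp (-(4 * π * I * (a - 1 / 4)) / τ) *
      (asymWeight (qtPow τ 2) t (cexp (4 * π * I * x)) * gaussExp τ (1 / 2 - a) x) := by
    simp only [F]
    rw [mul_add, Complex.exp_add, ← qtPow_two, mul_comm _ (qtPow τ 2),
      asymWeight_mul_left (qtPow_ne_zero τ 2), ← sub_eq_add_neg, gaussExp_sub_inv hτ0, ofReal_neg,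
      gaussExp_neg, cexp_four_pi_mul_neg, inv_inv, neg_sub]
    ring
  rw [hshift, htranslate, ← integral_neg_eq_self, asymMoment, ← integral_const_mul]
  simp_rw [hF_eq]

theorem asymMoment_reflect (hτ : 0 < τ.im) (ht : ‖t‖ < 1) (a : ℂ) :
    asymMoment τ t (-a) - t * asymMoment τ t (1 - a) =
      t * asymMoment τ t a - asymMoment τ t (a - 1) := by
  have h_int := integrable_asymWeight_mul_gaussExp hτ ht
  unfold asymMoment
  rw [← integral_const_mul, ← integral_const_mul, ← integral_sub (h_int _) ((h_int _).const_mul t),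
    ← integral_sub ((h_int _).const_mul t) (h_int _), ← integral_neg_eq_self]
  congr 1 with x
  have h := asymWeight_inv_mul (norm_qtPow_two_lt_one hτ) ht (norm_cexp_four_pi_mul_ofReal x)
  have h1 : gaussExp τ (a - 1) x = (cexp (4 * π * I * x))⁻¹ * gaussExp τ a x := by
    rw [sub_eq_add_neg, gaussExp_add, ← Complex.exp_neg]
    ring_nf
  rw [ofReal_neg, gaussExp_neg, gaussExp_neg, neg_neg, neg_sub, h1, cexp_four_pi_mul_neg]
  linear_combination gaussExp τ a x * h

theorem asymMoment_one (hτ : 0 < τ.im) (ht : ‖t‖ < 1) :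
    asymMoment τ t 1 = qtPow τ 2 * t * asymMoment τ t 0 := by
  have h1 := asymMoment_eq hτ ht 1
  have h2 := asymMoment_eq hτ ht 0
  have h3 := asymMoment_reflect hτ ht (1 / 2)
  rw [show (1 : ℂ) / 2 - 1 = -(1 / 2) by norm_num] at h1 h3
  rw [show (1 : ℂ) - 1 / 2 = 1 / 2 by norm_num] at h3
  rw [sub_zero] at h2
  have h4 : asymMoment τ t (-(1 / 2)) = t * asymMoment τ t (1 / 2) := by
    linear_combination h3 / 2
  have h5 : cexp (-(4 * π * I * (1 - 1 / 4)) / τ) =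
      qtPow τ 2 * cexp (-(4 * π * I * (0 - 1 / 4)) / τ) := by
    rw [qtPow, ← Complex.exp_add]
    ring_nf
  rw [h1, h4, h5, h2]
  ring

theorem asymMoment_neg_one (hτ : 0 < τ.im) (ht : ‖t‖ < 1) :
    asymMoment τ t (-1) = (qtPow τ 2 * t ^ 2 + t - 1) * asymMoment τ t 0 := by
  have h := asymMoment_reflect hτ ht 0
  rw [neg_zero, sub_zero, zero_sub, asymMoment_one hτ ht] at h
  linear_combination h

theorem asymMoment_mul_qtPow_two (hτ : 0 < τ.im) (ht : ‖t‖ < 1) :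
    asymMoment τ (t * qtPow τ 2) 0 =
      (1 + t * qtPow τ 2) * (1 - t ^ 2 * qtPow τ 2) * asymMoment τ t 0 := by
  have h_int := integrable_asymWeight_mul_gaussExp hτ ht
  have h : asymMoment τ (t * qtPow τ 2) 0 = (1 + t ^ 2 * qtPow τ 2) * asymMoment τ t 0 -
      t * asymMoment τ t 1 - t * qtPow τ 2 * asymMoment τ t (-1) := by
    unfold asymMoment
    rw [← integral_const_mul, ← integral_const_mul, ← integral_const_mul, ← integral_sub
      (by exact (h_int _).const_mul _) (by exact (h_int _).const_mul _), ← integral_sub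
      (by exact ((h_int _).const_mul _).sub ((h_int _).const_mul _)) (by exact (h_int _).const_mul _)]
    congr 1 with x
    have h0 : cexp (4 * π * I * x) ≠ 0 := Complex.exp_ne_zero _
    have h1 := gaussExp_add τ 0 1 x
    have h2 := gaussExp_add τ 0 (-1) x
    rw [show 4 * (π : ℂ) * I * -1 * x = -(4 * π * I * x) by ring, Complex.exp_neg] at h2
    rw [mul_one] at h1
    rw [zero_add] at h1 h2
    rw [asymWeight_mul_param (norm_qtPow_two_lt_one hτ) ht (norm_cexp_four_pi_mul_ofReal x), h1, h2]
    linear_combination asymWeight (qtPow τ 2) t (cexp (4 * π * I * x)) * gaussExp τ 0 x *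
      t ^ 2 * qtPow τ 2 * mul_inv_cancel₀ h0
  rw [h, asymMoment_one hτ ht, asymMoment_neg_one hτ ht]
  ring

theorem continuousAt_asymMoment_zero (hτ : 0 < τ.im) (a : ℂ) :
    ContinuousAt (fun t => asymMoment τ t a) 0 := by
  have hp := norm_qtPow_two_lt_one hτ
  obtain ⟨C, hC⟩ := exists_norm_asymWeight_mul_gaussExp_le hτ a one_half_lt_one
  have hball : ∀ᶠ t : ℂ in 𝓝 0, ‖t‖ ≤ 1 / 2 := by
    filter_upwards [Metric.closedBall_mem_nhds (0 : ℂ) one_half_pos] with t ht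
    simpa using ht
  refine continuousAt_of_dominated (bound := fun x => C * Real.exp (-(π * τ.im / 2) * x ^ 2))
    ?_ ?_ ((integrable_exp_neg_mul_sq (half_pos (mul_pos Real.pi_pos hτ))).const_mul C) ?_
  · filter_upwards [hball] with t ht
    exact (continuous_asymWeight_mul_gaussExp hτ (ht.trans_lt one_half_lt_one)
      a).aestronglyMeasurable
  · filter_upwards [hball] with t ht
    refine .of_forall fun x => ?_
    simpa using hC t ht x 0 ⟨le_rfl, (neg_inv_im_pos hτ).le⟩
  · refine .of_forall fun x => ?_
    have hx := norm_cexp_four_pi_mul_ofReal x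
    exact (continuousAt_asymWeight_param hp (by simp) (hx ▸ hp.le) hx.le).mul continuousAt_const

theorem asymMoment_zero_eq (hτ : 0 < τ.im) (ht : ‖t‖ < 1) : asymMoment τ t 0 =
    asymMoment τ 0 0 *
      (qPochInf (t * qtPow τ 2) (qtPow τ 2) / qPochInf (t ^ 2 * qtPow τ 2) (qtPow τ 2)) := by
  have hp := norm_qtPow_two_lt_one hτ
  have hstep {s : ℂ} (hs : ‖s‖ < 1) := asymMoment_mul_qtPow_two hτ hs
  generalize qtPow τ 2 = p at *
  have hden {s : ℂ} (hs : ‖s‖ < 1) : qPochInf (s * p) p ≠ 0 :=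
    qPochInf_ne_zero hp (norm_mul_lt_one hs hp.le)
  have hsq {s : ℂ} (hs : ‖s‖ < 1) : ‖s ^ 2‖ < 1 := by
    rw [sq]
    exact norm_mul_lt_one hs hs.le
  set Φ : ℂ → ℂ := fun s => asymMoment τ s 0 * qPochInf (s ^ 2 * p) p / qPochInf (s * p) p
  have hΦ {s : ℂ} (hs : ‖s‖ < 1) : Φ (s * p) = Φ s := by
    have h1 := hden hs
    have h2 := hden (norm_mul_lt_one hs hp.le)
    have h3 := qPochInf_eq_one_sub_mul hp (s * p)
    have h4 := qPochInf_eq_one_sub_mul hp (s ^ 2 * p)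
    rw [qPochInf_eq_one_sub_mul hp (s ^ 2 * p * p)] at h4
    simp only [Φ]
    rw [div_eq_div_iff h2 h1, hstep hs, h3, h4, show (s * p) ^ 2 * p = s ^ 2 * p * p * p by ring]
    ring
  have hpow (n : ℕ) : ‖t * p ^ n‖ < 1 := by
    refine norm_mul_lt_one ht ?_
    rw [norm_pow]
    exact pow_le_one₀ (norm_nonneg p) hp.le
  have hconst (n : ℕ) : Φ (t * p ^ n) = Φ t := by
    induction n with
    | zero => simp
    | succ n ih => rw [pow_succ, ← mul_assoc, hΦ (hpow n), ih]
  have hcont : ContinuousAt Φ 0 := by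
    have hc := (differentiable_qPochInf hp).continuous
    refine ((continuousAt_asymMoment_zero hτ 0).mul (Continuous.continuousAt ?_)).div
      (Continuous.continuousAt ?_) (by simp)
    · exact hc.comp (f := fun s => s ^ 2 * p) (by fun_prop)
    · exact hc.comp (f := fun s => s * p) (by fun_prop)
  have hlim : Tendsto (fun n : ℕ => t * p ^ n) atTop (𝓝 0) := by
    simpa using (tendsto_pow_atTop_nhds_zero_of_norm_lt_one hp).const_mul t
  have h := tendsto_nhds_unique (tendsto_const_nhds.congr fun n => (hconst n).symm)
    (hcont.tendsto.comp hlim)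
  have h0 : Φ 0 = asymMoment τ 0 0 := by simp [Φ]
  have h1 := hden ht
  have h2 := hden (hsq ht)
  rw [h0] at h
  rw [← h]
  simp only [Φ]
  field_simp

theorem asymMoment_zero_zero (hτ : 0 < τ.im) :
    asymMoment τ 0 0 = ((-I * τ) ^ (1 / 2 : ℂ))⁻¹ := by
  have hp := norm_qtPow_two_lt_one hτ
  have h_int := integrable_gaussExp hτ
  have h0 := integral_gaussExp hτ 0
  have h1 := integral_gaussExp hτ 1
  have h2 := integral_gaussExp hτ (-1)
  have hq : cexp (-(4 * π * I) / τ) = qtPow τ 2 := by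
    rw [qtPow]
    ring_nf
  simp only [one_pow, neg_sq, mul_one, hq] at h1 h2
  rw [zero_pow two_ne_zero, mul_zero, neg_zero, zero_div, Complex.exp_zero, mul_one] at h0
  have h : asymMoment τ (qtPow τ 2) 0 = (1 + qtPow τ 2) * (∫ x : ℝ, gaussExp τ 0 x) -
      (∫ x : ℝ, gaussExp τ 1 x) - qtPow τ 2 * ∫ x : ℝ, gaussExp τ (-1) x := by
    unfold asymMoment
    rw [← integral_const_mul, ← integral_const_mul, ← integral_sub
      (by exact (h_int _).const_mul _) (by exact h_int _), ← integral_sub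
      (by exact ((h_int _).const_mul _).sub (h_int _)) (by exact (h_int _).const_mul _)]
    congr 1 with x
    have hz : cexp (4 * π * I * x) ≠ 0 := Complex.exp_ne_zero _
    have h1 := gaussExp_add τ 0 1 x
    have h2 := gaussExp_add τ 0 (-1) x
    rw [show 4 * (π : ℂ) * I * -1 * x = -(4 * π * I * x) by ring, Complex.exp_neg] at h2
    rw [mul_one] at h1
    rw [zero_add] at h1 h2
    rw [asymWeight_self hp (norm_cexp_four_pi_mul_ofReal x), h1, h2]
    linear_combination gaussExp τ 0 x * qtPow τ 2 * mul_inv_cancel₀ hz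
  rw [asymMoment_zero_eq hτ hp, h0, h1, h2] at h
  generalize qtPow τ 2 = p at *
  have hpp : ‖p * p‖ < 1 := norm_mul_lt_one hp hp.le
  have hsub : 1 - p * p ≠ 0 := one_sub_mul_ne_zero hp hp.le
  rw [qPochInf_eq_one_sub_mul hp (p * p), ← sq, mul_div_assoc,
    div_self (qPochInf_ne_zero hp (by simpa [sq] using norm_mul_lt_one hpp hp.le)), mul_one] at h
  rw [← sq] at hsub
  refine mul_right_cancel₀ hsub (h.trans ?_)
  ring

theorem integral_symmWeight_mul_gaussExp (hτ : 0 < τ.im) (ht : ‖t‖ < 1) :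
    ∫ x : ℝ, qPochInf (cexp (4 * π * I * x)) (qtPow τ 2) *
        qPochInf (cexp (4 * π * I * x))⁻¹ (qtPow τ 2) /
      (qPochInf (t * cexp (4 * π * I * x)) (qtPow τ 2) *
        qPochInf (t * (cexp (4 * π * I * x))⁻¹) (qtPow τ 2)) * gaussExp τ 0 x =
    2 * ((-I * τ) ^ (1 / 2 : ℂ))⁻¹ *
      (qPochInf t (qtPow τ 2) / qPochInf (t ^ 2) (qtPow τ 2)) := by
  have hp := norm_qtPow_two_lt_one hτ
  have h_int := integrable_asymWeight_mul_gaussExp hτ ht 0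
  have hneg (x : ℝ) : asymWeight (qtPow τ 2) t (cexp (4 * π * I * (-x : ℝ))) *
      gaussExp τ 0 (-x : ℝ) =
      asymWeight (qtPow τ 2) t (cexp (4 * π * I * x))⁻¹ * gaussExp τ 0 x := by
    rw [ofReal_neg, gaussExp_neg, neg_zero, cexp_four_pi_mul_neg]
  have hrefl : asymMoment τ t 0 = ∫ x : ℝ, asymWeight (qtPow τ 2) t (cexp (4 * π * I * x))⁻¹ *
      gaussExp τ 0 x := by
    rw [asymMoment, ← integral_neg_eq_self]
    simp_rw [hneg]
  have h_int' : Integrable fun x : ℝ => asymWeight (qtPow τ 2) t (cexp (4 * π * I * x))⁻¹ *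
      gaussExp τ 0 x := by
    simpa only [hneg] using h_int.comp_neg
  have h1 : 1 - t ≠ 0 := by simpa using one_sub_mul_ne_zero (u := 1) ht (by simp)
  have h2 : 1 + t ≠ 0 := by simpa using one_sub_mul_ne_zero (u := -1) ht (by simp)
  have ht2 : ‖t ^ 2‖ < 1 := by
    rw [sq]
    exact norm_mul_lt_one ht ht.le
  have h3 := qPochInf_ne_zero hp (norm_mul_lt_one ht2 hp.le)
  have hsum : (1 + t) * ∫ x : ℝ, qPochInf (cexp (4 * π * I * x)) (qtPow τ 2) *
        qPochInf (cexp (4 * π * I * x))⁻¹ (qtPow τ 2) /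
      (qPochInf (t * cexp (4 * π * I * x)) (qtPow τ 2) *
        qPochInf (t * (cexp (4 * π * I * x))⁻¹) (qtPow τ 2)) * gaussExp τ 0 x =
      asymMoment τ t 0 + asymMoment τ t 0 := by
    nth_rw 2 [hrefl]
    rw [asymMoment, ← integral_const_mul, ← integral_add h_int h_int']
    congr 1 with x
    rw [← add_mul, asymWeight_add_asymWeight_inv hp ht (norm_cexp_four_pi_mul_ofReal x),
      mul_assoc (1 + t)]
  refine mul_left_cancel₀ h2 (hsum.trans ?_)
  rw [asymMoment_zero_eq hτ ht, asymMoment_zero_zero hτ, qPochInf_eq_one_sub_mul hp t,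
    qPochInf_eq_one_sub_mul hp (t ^ 2)]
  have h4 : 1 - t ^ 2 = (1 - t) * (1 + t) := by ring
  rw [h4]
  field_simp
  ring

end MacdonaldMehta

/-- Cherednik's one-variable Macdonald-Mehta integral: for `τ ∈ ℍ` and `k > 0`,
`∫_{-∞}^∞ (e^{4πix};q̃²)_∞(e^{-4πix};q̃²)_∞ /
((q̃^{2k}e^{4πix};q̃²)_∞(q̃^{2k}e^{-4πix};q̃²)_∞) · q^{x²/2} dx
= (2/√(-iτ)) (q̃^{2k};q̃²)_∞ / (q̃^{4k};q̃²)_∞`. -/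
theorem cherednik_macdonald_mehta (τ : ℂ) (hτ : 0 < τ.im) (k : ℝ) (hk : 0 < k) :
    (∫ x : ℝ,
      (qPochInf (Complex.exp (4 * (π : ℂ) * Complex.I * (x : ℂ))) (qtPow τ 2) *
        qPochInf (Complex.exp (-(4 * (π : ℂ) * Complex.I * (x : ℂ)))) (qtPow τ 2)) /
      (qPochInf (qtPow τ (2 * (k : ℂ)) * Complex.exp (4 * (π : ℂ) * Complex.I * (x : ℂ)))
          (qtPow τ 2) *
        qPochInf (qtPow τ (2 * (k : ℂ)) * Complex.exp (-(4 * (π : ℂ) * Complex.I * (x : ℂ))))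
          (qtPow τ 2)) *
      Complex.exp ((π : ℂ) * Complex.I * τ * (x : ℂ) ^ 2)) =
    2 * ((-Complex.I * τ) ^ (1 / 2 : ℂ))⁻¹ *
      (qPochInf (qtPow τ (2 * (k : ℂ))) (qtPow τ 2) /
        qPochInf (qtPow τ (4 * (k : ℂ))) (qtPow τ 2)) := by
  have ht : ‖qtPow τ (2 * k)‖ < 1 := by
    have h : qtPow τ (2 * k) = Complex.exp (4 * π * Complex.I * (k * -τ⁻¹)) := by
      rw [qtPow, div_eq_mul_inv]
      ring_nf
    rw [h, norm_cexp_four_pi_mul, Real.exp_lt_one_iff, Complex.im_ofReal_mul]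
    have := mul_pos Real.pi_pos (mul_pos hk (neg_inv_im_pos hτ))
    linarith
  have hsq : qtPow τ (2 * k) ^ 2 = qtPow τ (4 * k) := by
    rw [qtPow, qtPow, ← Complex.exp_nat_mul]
    ring_nf
  simpa [gaussExp, ← Complex.exp_neg, hsq] using integral_symmWeight_mul_gaussExp hτ ht
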